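/- Suppose q > 2 and let x ∈ J(S) with x ∉ ⁅S,S⁆. Then C_S(x) = J(S). -/

import Mathlib

open Matrix

/-- The `q`-power Frobenius `x ↦ x ^ (pⁿ)` on `K = GF(q²)` where `q = pⁿ`. -/
noncomputable def frobq (p n : ℕ) [Fact p.Prime] :
    GaloisField p (2 * n) →+* GaloisField p (2 * n) :=
  iterateFrobenius (GaloisField p (2 * n)) p n

/-- `SU₄(q)`: the subgroup of `SL₄(GF(q²))` of all matrices `A` with `Aᵀ ⬝ σ(A) = 1`,
where `σ` is the `q`-power Frobenius applied entrywise. -/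
def SU4 (p n : ℕ) [Fact p.Prime] :
    Subgroup (SpecialLinearGroup (Fin 4) (GaloisField p (2 * n))) where
  carrier := {A | (A : Matrix (Fin 4) (Fin 4) (GaloisField p (2 * n)))ᵀ *
      (A : Matrix (Fin 4) (Fin 4) (GaloisField p (2 * n))).map (frobq p n) = 1}
  one_mem' := by
    simp
  mul_mem' := by
    intro A B hA hB
    simp only [Set.mem_setOf_eq, Matrix.SpecialLinearGroup.coe_mul, Matrix.transpose_mul,
      Matrix.map_mul] at *
    calc (B : Matrix (Fin 4) (Fin 4) (GaloisField p (2*n)))ᵀ * (A : Matrix _ _ _)ᵀ *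
          ((A : Matrix _ _ _).map (frobq p n) * (B : Matrix _ _ _).map (frobq p n))
        = (B : Matrix (Fin 4) (Fin 4) (GaloisField p (2*n)))ᵀ *
            (((A : Matrix _ _ _)ᵀ * (A : Matrix _ _ _).map (frobq p n)) *
              (B : Matrix _ _ _).map (frobq p n)) := by
          noncomm_ring
      _ = 1 := by rw [hA, one_mul, hB]
  inv_mem' := by
    intro A hA
    simp only [Set.mem_setOf_eq] at *
    have h1 : (A : Matrix (Fin 4) (Fin 4) (GaloisField p (2*n))) *
        ((A⁻¹ : SpecialLinearGroup (Fin 4) (GaloisField p (2*n))) : Matrix _ _ _) = 1 := by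
      rw [← Matrix.SpecialLinearGroup.coe_mul, mul_inv_cancel,
        Matrix.SpecialLinearGroup.coe_one]
    have hBt : ((A⁻¹ : SpecialLinearGroup (Fin 4) (GaloisField p (2*n))) : Matrix _ _ _)ᵀ =
        (A : Matrix (Fin 4) (Fin 4) (GaloisField p (2*n))).map (frobq p n) := by
      calc ((A⁻¹ : SpecialLinearGroup (Fin 4) (GaloisField p (2*n))) : Matrix _ _ _)ᵀ
          = ((A⁻¹ : SpecialLinearGroup (Fin 4) (GaloisField p (2*n))) : Matrix _ _ _)ᵀ *
            ((A : Matrix (Fin 4) (Fin 4) (GaloisField p (2*n)))ᵀ *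
              (A : Matrix _ _ _).map (frobq p n)) := by rw [hA, mul_one]
        _ = (((A : Matrix (Fin 4) (Fin 4) (GaloisField p (2*n))) *
              ((A⁻¹ : SpecialLinearGroup (Fin 4) (GaloisField p (2*n))) : Matrix _ _ _))ᵀ) *
            (A : Matrix _ _ _).map (frobq p n) := by
            rw [Matrix.transpose_mul]; noncomm_ring
        _ = (A : Matrix (Fin 4) (Fin 4) (GaloisField p (2*n))).map (frobq p n) := by
            rw [h1, Matrix.transpose_one, one_mul]
    rw [hBt, ← Matrix.map_mul, h1, Matrix.map_one (frobq p n) (map_zero _) (map_one _)]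

/-- `PSU₄(q)`: the quotient of `SU₄(q)` by its center. -/
noncomputable abbrev PSU4 (p n : ℕ) [Fact p.Prime] :=
  ↥(SU4 p n) ⧸ Subgroup.center ↥(SU4 p n)

/-- A subgroup is elementary abelian (for the prime `p`) if it is commutative and every
element has order dividing `p`. -/
def IsElementaryAbelian (p : ℕ) {G : Type*} [Group G] (A : Subgroup G) : Prop :=
  (∀ x ∈ A, ∀ y ∈ A, x * y = y * x) ∧ ∀ x ∈ A, x ^ p = 1

/-- The Thompson subgroup `J(G)`: the subgroup generated by all elementary abelian
subgroups of maximal order. -/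
def Thompson (p : ℕ) (G : Type*) [Group G] : Subgroup G :=
  ⨆ A ∈ {A : Subgroup G | IsElementaryAbelian p A ∧
      ∀ B : Subgroup G, IsElementaryAbelian p B → Nat.card B ≤ Nat.card A}, A

section ThompsonCriterion

/-- A subgroup which is elementary abelian and strictly larger than every elementary abelian
subgroup it does not contain is the Thompson subgroup. -/
theorem thompson_eq_of_isElementaryAbelian {p : ℕ} {G : Type*} [Group G] [Finite G]
    {H : Subgroup G} (hH : IsElementaryAbelian p H)
    (hlt : ∀ A : Subgroup G, IsElementaryAbelian p A → ¬ A ≤ H → Nat.card A < Nat.card H) :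
    Thompson p G = H := by
  apply le_antisymm
  · refine iSup₂_le fun A hA => ?_
    by_contra hle
    exact absurd (hA.2 H hH) (not_le.mpr (hlt A hA.1 hle))
  · refine le_iSup₂_of_le H ⟨hH, fun B hB => ?_⟩ le_rfl
    by_cases hle : B ≤ H
    · exact Subgroup.card_le_of_le hle
    · exact (hlt B hB hle).le

theorem IsElementaryAbelian.map {p : ℕ} {G G' : Type*} [Group G] [Group G'] {A : Subgroup G}
    (hA : IsElementaryAbelian p A) (f : G →* G') : IsElementaryAbelian p (A.map f) := by
  refine ⟨?_, ?_⟩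
  · rintro _ ⟨x, hx, rfl⟩ _ ⟨y, hy, rfl⟩
    rw [← map_mul, hA.1 x hx y hy, map_mul]
  · rintro _ ⟨x, hx, rfl⟩
    rw [← map_pow, hA.2 x hx, map_one]

end ThompsonCriterion

/-- Coordinates for the upper unitriangular matrices preserving the Hermitian form with
antidiagonal Gram matrix, for an involution `σ` of a field. -/
@[ext]
structure UnitriangularUnitary {K : Type*} [Field K] (σ : K →+* K) where
  a : K
  b : K
  r : K
  d : K
  r_skew : r + σ r = 0
  d_skew : d + a * σ b + σ (d + a * σ b) = 0

namespace UnitriangularUnitary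

variable {K : Type*} [Field K] {σ : K →+* K}

instance : One (UnitriangularUnitary σ) where
  one := ⟨0, 0, 0, 0, by simp, by simp⟩

@[simp] theorem one_a : (1 : UnitriangularUnitary σ).a = 0 := rfl
@[simp] theorem one_b : (1 : UnitriangularUnitary σ).b = 0 := rfl
@[simp] theorem one_r : (1 : UnitriangularUnitary σ).r = 0 := rfl
@[simp] theorem one_d : (1 : UnitriangularUnitary σ).d = 0 := rfl

theorem skew_of_a_eq_zero {x : UnitriangularUnitary σ} (hx : x.a = 0) : x.d + σ x.d = 0 := by
  simpa [hx] using x.d_skew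

/-- The element of the abelian part with coordinates `b, r, d`. -/
def ofSkew (b r d : K) (hr : r + σ r = 0) (hd : d + σ d = 0) : UnitriangularUnitary σ :=
  ⟨0, b, r, d, hr, by simpa using hd⟩

/-- The element with only nonzero coordinate `a`. -/
def ofA (σ : K →+* K) (a : K) : UnitriangularUnitary σ := ⟨a, 0, 0, 0, by simp, by simp⟩

theorem exists_trace_eq_one (hσ : Function.Involutive σ) {u : K} (hu : σ u ≠ u) :
    ∃ l : K, l + σ l = 1 := by
  have hne : u - σ u ≠ 0 := sub_ne_zero.mpr hu.symm
  have hne' : σ u - u ≠ 0 := sub_ne_zero.mpr hu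
  refine ⟨u / (u - σ u), ?_⟩
  rw [map_div₀, map_sub, hσ u]
  field_simp
  ring

/-- The elements fixed by `σ`. -/
abbrev fixedElements (σ : K →+* K) : Set K := {x | σ x = x}

/-- The elements negated by `σ`. -/
abbrev skewElements (σ : K →+* K) : Set K := {x | x + σ x = 0}

theorem card_le_fixed_of_proportional [Finite K] {s : Set K} {c : K} (hc : c ≠ 0)
    (h : ∀ x ∈ s, x * σ c = c * σ x) : Nat.card s ≤ Nat.card (fixedElements σ) := by
  refine Nat.card_le_card_of_injective (fun x : s => (⟨x.1 / c, ?_⟩ : fixedElements σ)) ?_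
  · have hsc : σ c ≠ 0 := (map_ne_zero σ).mpr hc
    rw [Set.mem_ofPred_eq, map_div₀, div_eq_div_iff hsc hc, h x.1 x.2, mul_comm]
  · intro x y hxy
    have := congrArg Subtype.val hxy
    exact Subtype.ext ((div_left_inj' hc).mp this)

theorem one_lt_card_fixedElements [Finite K] : 1 < Nat.card (fixedElements σ) := by
  rw [Finite.one_lt_card_iff_nontrivial]
  exact ⟨⟨0, map_zero σ⟩, ⟨1, map_one σ⟩, fun h => zero_ne_one (congrArg Subtype.val h)⟩

variable [hσ : Fact (Function.Involutive σ)]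

instance : Mul (UnitriangularUnitary σ) where
  mul x y :=
    { a := x.a + y.a
      b := y.b + x.a * y.r + x.b
      r := x.r + y.r
      d := y.d + x.a * (-σ y.b - y.r * σ y.a) - x.b * σ y.a + x.d
      r_skew := by
        have h1 := x.r_skew
        have h2 := y.r_skew
        simp only [map_add]
        linear_combination h1 + h2
      d_skew := by
        have h1 := x.d_skew
        have h2 := y.d_skew
        have h3 := y.r_skew
        simp only [map_add, map_sub, map_mul, map_neg, hσ.out _] at *
        linear_combination h1 + h2 + x.a * σ x.a * h3 }

instance : Inv (UnitriangularUnitary σ) where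
  inv x :=
    { a := -x.a
      b := x.a * x.r - x.b
      r := -x.r
      d := -x.d - x.a * σ x.b - x.b * σ x.a
      r_skew := by
        have h := x.r_skew
        simp only [map_neg]
        linear_combination -h
      d_skew := by
        have h1 := x.d_skew
        have h2 := x.r_skew
        simp only [map_add, map_sub, map_mul, map_neg, hσ.out _] at *
        linear_combination -h1 - x.a * σ x.a * h2 }

@[simp] theorem mul_a (x y : UnitriangularUnitary σ) : (x * y).a = x.a + y.a := rfl
@[simp] theorem mul_b (x y : UnitriangularUnitary σ) :
    (x * y).b = y.b + x.a * y.r + x.b := rfl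
@[simp] theorem mul_r (x y : UnitriangularUnitary σ) : (x * y).r = x.r + y.r := rfl
@[simp] theorem mul_d (x y : UnitriangularUnitary σ) :
    (x * y).d = y.d + x.a * (-σ y.b - y.r * σ y.a) - x.b * σ y.a + x.d := rfl
@[simp] theorem inv_a (x : UnitriangularUnitary σ) : x⁻¹.a = -x.a := rfl
@[simp] theorem inv_b (x : UnitriangularUnitary σ) : x⁻¹.b = x.a * x.r - x.b := rfl
@[simp] theorem inv_r (x : UnitriangularUnitary σ) : x⁻¹.r = -x.r := rfl
@[simp] theorem inv_d (x : UnitriangularUnitary σ) :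
    x⁻¹.d = -x.d - x.a * σ x.b - x.b * σ x.a := rfl

instance : Group (UnitriangularUnitary σ) :=
  Group.ofLeftAxioms
    (fun x y z => by
      ext <;> simp only [mul_a, mul_b, mul_r, mul_d, map_add, map_mul]
      · ring
      · ring
      · ring
      · linear_combination (x.a * σ y.a) * z.r_skew)
    (fun x => by ext <;> simp)
    (fun x => by
      ext <;> simp only [mul_a, mul_b, mul_r, mul_d, inv_a, inv_b, inv_r, inv_d, one_a, one_b,
        one_r, one_d] <;> ring)

instance [Finite K] : Finite (UnitriangularUnitary σ) :=
  Finite.of_injective (fun x : UnitriangularUnitary σ => (x.a, x.b, x.r, x.d)) fun x y h => by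
    simp only [Prod.mk.injEq] at h
    exact UnitriangularUnitary.ext h.1 h.2.1 h.2.2.1 h.2.2.2

/-- The quotient of the group by its abelian subgroup `a = 0`. -/
def aHom (σ : K →+* K) [Fact (Function.Involutive σ)] :
    UnitriangularUnitary σ →* Multiplicative K where
  toFun x := Multiplicative.ofAdd x.a
  map_one' := rfl
  map_mul' _ _ := rfl

/-- The abelian normal subgroup `a = 0`. -/
def abelianPart (σ : K →+* K) [Fact (Function.Involutive σ)] :
    Subgroup (UnitriangularUnitary σ) := (aHom σ).ker

theorem mem_abelianPart {x : UnitriangularUnitary σ} : x ∈ abelianPart σ ↔ x.a = 0 := by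
  simp [abelianPart, aHom, MonoidHom.mem_ker]

theorem pow_a (x : UnitriangularUnitary σ) (m : ℕ) : (x ^ m).a = m * x.a := by
  induction m with
  | zero => simp
  | succ m ih => rw [pow_succ, mul_a, ih]; push_cast; ring

theorem pow_of_a_eq_zero {x : UnitriangularUnitary σ} (hx : x.a = 0) (m : ℕ) :
    (x ^ m).b = m * x.b ∧ (x ^ m).r = m * x.r ∧ (x ^ m).d = m * x.d := by
  induction m with
  | zero => simp
  | succ m ih =>
    have ha : (x ^ m).a = 0 := by rw [pow_a, hx, mul_zero]
    rw [pow_succ, mul_b, mul_r, mul_d, ih.1, ih.2.1, ih.2.2, hx, ha, map_zero]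
    push_cast
    refine ⟨?_, ?_, ?_⟩ <;> ring

theorem pow_char_eq_one {x : UnitriangularUnitary σ} (hx : x.a = 0) (p : ℕ) [CharP K p] :
    x ^ p = 1 := by
  obtain ⟨hb, hr, hd⟩ := pow_of_a_eq_zero hx p
  ext
  · simp [pow_a]
  · simp [hb]
  · simp [hr]
  · simp [hd]

theorem isPGroup (p : ℕ) [CharP K p] : IsPGroup p (UnitriangularUnitary σ) := fun x => by
  refine ⟨2, ?_⟩
  rw [pow_two, pow_mul]
  exact pow_char_eq_one (by simp [pow_a]) p

theorem isElementaryAbelian_abelianPart (p : ℕ) [CharP K p] :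
    IsElementaryAbelian p (abelianPart σ) := by
  refine ⟨fun x hx y hy => ?_, fun x hx => pow_char_eq_one (mem_abelianPart.mp hx) p⟩
  rw [mem_abelianPart] at hx hy
  ext <;> simp [hx, hy, add_comm]

/-- An element of the abelian part commuting with an element outside it has `r = 0`, and its
coordinate `b` is a multiple of `a` by a `σ`-fixed scalar. -/
theorem eq_of_commute {x y : UnitriangularUnitary σ} (hx : x.a = 0) (hy : y.a ≠ 0)
    (hxy : x * y = y * x) : x.r = 0 ∧ x.b * σ y.a = y.a * σ x.b := by
  have hb := congrArg UnitriangularUnitary.b hxy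
  have hd := congrArg UnitriangularUnitary.d hxy
  simp only [mul_b, mul_d, hx, map_zero] at hb hd
  have hr : x.r = 0 := by
    have : y.a * x.r = 0 := by linear_combination -hb
    exact (mul_eq_zero.mp this).resolve_left hy
  exact ⟨hr, by linear_combination -hd⟩

open scoped commutatorElement in
/-- Every element with `a = r = 0` is a commutator. -/
theorem exists_commutator_eq {u : K} (hu : σ u ≠ u) {x : UnitriangularUnitary σ}
    (ha : x.a = 0) (hr : x.r = 0) : ∃ y z : UnitriangularUnitary σ, ⁅y, z⁆ = x := by
  have hd := skew_of_a_eq_zero ha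
  obtain ⟨l, hl⟩ := exists_trace_eq_one hσ.out hu
  obtain ⟨a, r, hane, hrs, hb⟩ : ∃ a r : K, a ≠ 0 ∧ r + σ r = 0 ∧ a * r = x.b := by
    by_cases hb : x.b = 0
    · exact ⟨1, 0, one_ne_zero, by simp, by simp [hb]⟩
    · have hne : u - σ u ≠ 0 := sub_ne_zero.mpr hu.symm
      exact ⟨x.b / (u - σ u), u - σ u, div_ne_zero hb hne, by rw [map_sub, hσ.out u]; ring,
        div_mul_cancel₀ _ hne⟩
  have hsa : σ a ≠ 0 := (map_ne_zero σ).mpr hane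
  set t : K := x.d - r * a * σ a with ht
  have hts : t + σ t = 0 := by
    simp only [ht, map_sub, map_mul, hσ.out a]
    linear_combination hd - a * σ a * hrs
  obtain ⟨b, hbt⟩ : ∃ b : K, b * σ a - a * σ b = t := by
    have hst : σ t = -t := by linear_combination hts
    refine ⟨l * t / σ a, ?_⟩
    rw [map_div₀, map_mul, hσ.out a, hst]
    field_simp
    linear_combination t * hl
  refine ⟨ofA σ a, ofSkew b r 0 hrs (by simp), ?_⟩
  rw [commutatorElement_def, mul_inv_eq_iff_eq_mul, mul_inv_eq_iff_eq_mul]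
  ext
  · simp [ofA, ofSkew, ha]
  · simp [ofA, ofSkew, ha, ← hb, add_comm]
  · simp [ofA, ofSkew, hr]
  · simp only [ofA, ofSkew, mul_a, mul_b, mul_d, ha, ← hb, map_zero]
    linear_combination ht + hbt

theorem card_skewElements {u : K} (hu : σ u ≠ u) :
    Nat.card (skewElements σ) = Nat.card (fixedElements σ) := by
  have hne : u - σ u ≠ 0 := sub_ne_zero.mpr hu.symm
  have hs : σ (u - σ u) = -(u - σ u) := by rw [map_sub, hσ.out u]; ring
  refine Nat.card_congr
    { toFun := fun x => ⟨x.1 / (u - σ u), ?_⟩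
      invFun := fun x => ⟨x.1 * (u - σ u), ?_⟩
      left_inv := fun x => Subtype.ext (div_mul_cancel₀ _ hne)
      right_inv := fun x => Subtype.ext (mul_div_cancel_right₀ _ hne) }
  · have hx : σ x.1 = -x.1 := by linear_combination x.2.out
    simp only [Set.mem_ofPred_eq, map_div₀, hs, hx, neg_div_neg_eq]
  · simp only [Set.mem_ofPred_eq, map_mul, hs, x.2.out]
    ring

theorem card_eq_sq {u : K} (hu : σ u ≠ u) : Nat.card K = Nat.card (fixedElements σ) ^ 2 := by
  obtain ⟨l, hl⟩ := exists_trace_eq_one hσ.out hu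
  rw [pow_two]
  nth_rewrite 2 [← card_skewElements hu]
  rw [← Nat.card_prod]
  refine Nat.card_congr
    { toFun := fun x => (⟨x + σ x, ?_⟩, ⟨x - l * (x + σ x), ?_⟩)
      invFun := fun y => l * y.1.1 + y.2.1
      left_inv := fun x => by simp
      right_inv := ?_ }
  · simp only [Set.mem_ofPred_eq, map_add, hσ.out x]
    ring
  · simp only [Set.mem_ofPred_eq, map_add, map_sub, map_mul, hσ.out x]
    linear_combination -(x + σ x) * hl
  · rintro ⟨⟨f, hf⟩, ⟨s, hs⟩⟩
    have hf' : σ f = f := hf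
    have hs' : σ s = -s := by linear_combination hs.out
    have h1 : l * f + s + σ (l * f + s) = f := by
      rw [map_add, map_mul, hf', hs']
      linear_combination f * hl
    simp only [Prod.mk.injEq, Subtype.mk.injEq]
    refine ⟨h1, ?_⟩
    rw [h1]
    ring

theorem card_abelianPart {u : K} (hu : σ u ≠ u) :
    Nat.card (abelianPart σ) = Nat.card (fixedElements σ) ^ 4 := by
  have h : Nat.card (abelianPart σ) = Nat.card (K × skewElements σ × skewElements σ) := by
    refine Nat.card_congr
      { toFun := fun x => (x.1.b, ⟨x.1.r, x.1.r_skew⟩,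
          ⟨x.1.d, skew_of_a_eq_zero (mem_abelianPart.mp x.2)⟩)
        invFun := fun y => ⟨ofSkew y.1 y.2.1.1 y.2.2.1 y.2.1.2 y.2.2.2, mem_abelianPart.mpr rfl⟩
        left_inv := fun x => ?_
        right_inv := fun y => rfl }
    exact Subtype.ext
      (UnitriangularUnitary.ext (mem_abelianPart.mp x.2).symm rfl rfl rfl)
  rw [h, Nat.card_prod, Nat.card_prod, card_skewElements hu, card_eq_sq hu]
  ring

/-- An abelian subgroup not contained in the abelian part is smaller than it. -/
theorem card_lt_card_abelianPart [Finite K] {u : K} (hu : σ u ≠ u) {A : Subgroup (UnitriangularUnitary σ)}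
    (hA : ∀ x ∈ A, ∀ y ∈ A, x * y = y * x) (hle : ¬ A ≤ abelianPart σ) :
    Nat.card A < Nat.card (abelianPart σ) := by
  obtain ⟨y, hyA, hy⟩ := SetLike.not_le_iff_exists.mp hle
  rw [mem_abelianPart] at hy
  set q := Nat.card (fixedElements σ) with hq
  set V : Set K := {a | ∃ x ∈ A, x.a = a} with hV
  set W : Set K := {b | ∃ x ∈ A, x.a = 0 ∧ x.b = b} with hW
  have hcard : Nat.card A = Nat.card (A ⊓ abelianPart σ : Subgroup _) * Nat.card V := by
    have h1 := Subgroup.card_mul_index ((abelianPart σ).subgroupOf A)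
    have h2 : ((abelianPart σ).subgroupOf A).index = Nat.card (A.map (aHom σ)) :=
      Subgroup.relIndex_ker A (aHom σ)
    rw [← h1, h2, ← Subgroup.inf_subgroupOf_left,
      Nat.card_congr (Subgroup.subgroupOfEquivOfLe inf_le_left).toEquiv]
    rfl
  have hinf : Nat.card (A ⊓ abelianPart σ : Subgroup _) ≤ Nat.card W * q := by
    rw [hq, ← card_skewElements hu, ← Nat.card_prod]
    refine Nat.card_le_card_of_injective
      (fun x => ((⟨x.1.b, x.1, x.2.1, mem_abelianPart.mp x.2.2, rfl⟩,
        ⟨x.1.d, skew_of_a_eq_zero (mem_abelianPart.mp x.2.2)⟩) : W × skewElements σ)) ?_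
    intro x z hxz
    simp only [Prod.mk.injEq, Subtype.mk.injEq] at hxz
    have hx0 := mem_abelianPart.mp x.2.2
    have hz0 := mem_abelianPart.mp z.2.2
    exact Subtype.ext (UnitriangularUnitary.ext (hx0.trans hz0.symm) hxz.1
      ((eq_of_commute hx0 hy (hA _ x.2.1 _ hyA)).1.trans
        (eq_of_commute hz0 hy (hA _ z.2.1 _ hyA)).1.symm) hxz.2)
  have hWV : Nat.card W * Nat.card V ≤ q ^ 2 := by
    by_cases hW0 : W ⊆ {0}
    · have h1 : Nat.card W ≤ 1 := by
        have := Nat.card_mono (Set.finite_singleton (0 : K)) hW0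
        simpa using this
      have h2 : Nat.card V ≤ q ^ 2 := by
        rw [hq, ← card_eq_sq hu]
        exact Nat.card_le_card_of_injective _ Subtype.val_injective
      calc Nat.card W * Nat.card V ≤ 1 * q ^ 2 := Nat.mul_le_mul h1 h2
        _ = q ^ 2 := one_mul _
    · obtain ⟨_, ⟨x, hxA, hxa, rfl⟩, hxb⟩ := Set.not_subset.mp hW0
      have hxb : x.b ≠ 0 := hxb
      rw [pow_two]
      refine Nat.mul_le_mul (card_le_fixed_of_proportional hy ?_)
        (card_le_fixed_of_proportional hxb ?_)
      · rintro _ ⟨z, hzA, hza, rfl⟩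
        exact (eq_of_commute hza hy (hA z hzA y hyA)).2
      · rintro _ ⟨z, hzA, rfl⟩
        by_cases hz : z.a = 0
        · simp [hz]
        · exact (eq_of_commute hxa hz (hA x hxA z hzA)).2.symm
  have hq1 : 1 < q := one_lt_card_fixedElements
  calc Nat.card A ≤ Nat.card W * q * Nat.card V := hcard ▸ Nat.mul_le_mul_right _ hinf
    _ = Nat.card W * Nat.card V * q := by ring
    _ ≤ q ^ 2 * q := Nat.mul_le_mul_right _ hWV
    _ = q ^ 3 := by ring
    _ < q ^ 4 := Nat.pow_lt_pow_right hq1 (by norm_num)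
    _ = Nat.card (abelianPart σ) := (card_abelianPart hu).symm

/-- In a group isomorphic to the unitriangular unitary group, the centralizer of an element of
the Thompson subgroup outside the derived subgroup is the Thompson subgroup. -/
theorem centralizer_eq_thompson [Finite K] {u : K} (hu : σ u ≠ u) (p : ℕ) [CharP K p]
    {G : Type*} [Group G] (e : G ≃* UnitriangularUnitary σ) {x : G} (hx : x ∈ Thompson p G)
    (hx' : x ∉ (⁅(⊤ : Subgroup G), ⊤⁆ : Subgroup G)) :
    Subgroup.centralizer ({x} : Set G) = Thompson p G := by
  have : Finite G := Finite.of_equiv _ e.symm.toEquiv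
  have hmap : ∀ A : Subgroup G, Nat.card (A.map e.toMonoidHom) = Nat.card A := fun A =>
    Subgroup.card_map_of_injective e.injective
  have hH := (isElementaryAbelian_abelianPart (σ := σ) p).map e.symm.toMonoidHom
  have hmem : ∀ y : G, y ∈ (abelianPart σ).map e.symm.toMonoidHom ↔ (e y).a = 0 := fun y => by
    rw [← mem_abelianPart]
    exact Subgroup.mem_map_equiv
  have hT : Thompson p G = (abelianPart σ).map e.symm.toMonoidHom := by
    refine thompson_eq_of_isElementaryAbelian hH fun A hA hle => ?_
    have hcardH : Nat.card ((abelianPart σ).map e.symm.toMonoidHom) = Nat.card (abelianPart σ) :=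
      Subgroup.card_map_of_injective e.symm.injective
    rw [hcardH, ← hmap A]
    refine card_lt_card_abelianPart hu (hA.map e.toMonoidHom).1 fun h => hle fun y hy => ?_
    rw [hmem, ← mem_abelianPart]
    exact h (Subgroup.mem_map_of_mem _ hy)
  rw [hT] at hx ⊢
  ext y
  rw [Subgroup.mem_centralizer_singleton_iff]
  constructor
  · intro hxy
    by_contra hy
    rw [hmem] at hx hy
    have hr := (eq_of_commute hx hy (by rw [← map_mul, ← map_mul, hxy])).1
    obtain ⟨v, w, hvw⟩ := exists_commutator_eq hu hx hr
    refine hx' ?_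
    rw [← e.symm_apply_apply x, ← hvw, map_commutatorElement e.symm v w]
    exact Subgroup.commutator_mem_commutator (Subgroup.mem_top _) (Subgroup.mem_top _)
  · exact fun hy => hH.1 _ hy _ hx

end UnitriangularUnitary

namespace UnitriangularUnitary

variable {K : Type*} [Field K] {σ : K →+* K}

/-- The matrix of an element of the unitriangular unitary group. -/
def toMatrix (x : UnitriangularUnitary σ) : Matrix (Fin 4) (Fin 4) K :=
  !![1, x.a, x.b, x.d; 0, 1, x.r, -σ x.b - x.r * σ x.a; 0, 0, 1, -σ x.a; 0, 0, 0, 1]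

theorem toMatrix_one : toMatrix (1 : UnitriangularUnitary σ) = 1 := by
  ext i j
  fin_cases i <;> fin_cases j <;> simp [toMatrix]

theorem toMatrix_injective :
    Function.Injective (toMatrix : UnitriangularUnitary σ → Matrix (Fin 4) (Fin 4) K) := by
  intro x y h
  exact UnitriangularUnitary.ext (congrFun₂ h 0 1) (congrFun₂ h 0 2) (congrFun₂ h 1 2)
    (congrFun₂ h 0 3)

theorem det_toMatrix (x : UnitriangularUnitary σ) : (toMatrix x).det = 1 := by
  rw [Matrix.det_of_isUpperTriangular]
  · simp [toMatrix, Fin.prod_univ_four]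
  · intro i j hij
    fin_cases i <;> fin_cases j <;> simp [toMatrix] at hij ⊢

/-- The antidiagonal Gram matrix of the Hermitian form. -/
def antidiagonal (K : Type*) [Field K] : Matrix (Fin 4) (Fin 4) K :=
  !![0, 0, 0, 1; 0, 0, 1, 0; 0, 1, 0, 0; 1, 0, 0, 0]

theorem antidiagonal_mul_self : antidiagonal K * antidiagonal K = 1 := by
  ext i j
  fin_cases i <;> fin_cases j <;> simp [antidiagonal, Matrix.mul_apply, Fin.sum_univ_four]

theorem antidiagonal_map (σ : K →+* K) : (antidiagonal K).map σ = antidiagonal K := by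
  ext i j
  fin_cases i <;> fin_cases j <;> simp [antidiagonal]

theorem antidiagonal_transpose : (antidiagonal K)ᵀ = antidiagonal K := by
  ext i j
  fin_cases i <;> fin_cases j <;> simp [antidiagonal]

theorem det_antidiagonal : (antidiagonal K).det = 1 := by
  simp [antidiagonal, Matrix.det_succ_row_zero, Fin.sum_univ_succ, Fin.succAbove]
  ring

/-- A unitriangular matrix commuting with the antidiagonal matrix is trivial. -/
theorem eq_one_of_commute_antidiagonal {x : UnitriangularUnitary σ}
    (h : toMatrix x * antidiagonal K = antidiagonal K * toMatrix x) : x = 1 := by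
  have h01 := congrFun₂ h 0 2
  have h02 := congrFun₂ h 0 1
  have h03 := congrFun₂ h 0 0
  have h12 := congrFun₂ h 1 1
  simp [toMatrix, antidiagonal, Matrix.mul_apply, Fin.sum_univ_four] at h01 h02 h03 h12
  exact UnitriangularUnitary.ext h01 h02 h12 h03

theorem exists_hyperbolic_basis (hσ : Function.Involutive σ) {u : K} (hu : σ u ≠ u) {c : K}
    (hc : c * σ c = -1) : ∃ M N : Matrix (Fin 4) (Fin 4) K,
      M * N = 1 ∧ N * M = 1 ∧ Mᵀ * M.map σ = antidiagonal K := by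
  obtain ⟨l, hl⟩ := exists_trace_eq_one hσ hu
  set M : Matrix (Fin 4) (Fin 4) K :=
    !![1, 0, 0, 1 - l; c, 0, 0, -l * c; 0, 1, 1 - l, 0; 0, c, -l * c, 0] with hM
  have hJ : Mᵀ * M.map σ = antidiagonal K := by
    ext i j
    fin_cases i <;> fin_cases j <;>
      simp [hM, antidiagonal, Matrix.mul_apply, Fin.sum_univ_four]
    · linear_combination hc
    · linear_combination (-σ l) * hc
    · linear_combination hc
    · linear_combination (-σ l) * hc
    · linear_combination (-l) * hc
    · linear_combination l * σ l * hc - hl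
    · linear_combination (-l) * hc
    · linear_combination l * σ l * hc - hl
  have hNM : antidiagonal K * (M.map σ)ᵀ * M = 1 := by
    have hMM : (M.map σ).map σ = M := by
      ext i j
      exact hσ _
    have h := congrArg (fun X : Matrix (Fin 4) (Fin 4) K => X.map σ) hJ
    simp only [Matrix.map_mul, hMM, antidiagonal_map, Matrix.transpose_map] at h
    rw [Matrix.mul_assoc, h, antidiagonal_mul_self]
  exact ⟨M, _, mul_eq_one_comm.mp hNM, hNM, hJ⟩

variable [hσ : Fact (Function.Involutive σ)]

theorem toMatrix_mul (x y : UnitriangularUnitary σ) :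
    toMatrix (x * y) = toMatrix x * toMatrix y := by
  have h := y.r_skew
  ext i j
  fin_cases i <;> fin_cases j <;>
    simp [toMatrix, Matrix.mul_apply, Fin.sum_univ_four]
  · ring
  · ring
  · ring
  · linear_combination (-σ x.a) * h

theorem toMatrix_isometry (x : UnitriangularUnitary σ) :
    (toMatrix x)ᵀ * antidiagonal K * (toMatrix x).map σ = antidiagonal K := by
  have hr := x.r_skew
  have hd := x.d_skew
  simp only [map_add, map_mul, hσ.out _] at hd
  ext i j
  fin_cases i <;> fin_cases j <;>
    simp [toMatrix, antidiagonal, Matrix.mul_apply, Fin.sum_univ_four, hσ.out _]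
  · linear_combination hr
  · linear_combination (-x.a) * hr
  · linear_combination (-σ x.a) * hr
  · linear_combination hd + x.a * σ x.a * hr

/-- An upper unitriangular isometry comes from the unitriangular unitary group. -/
theorem exists_toMatrix_eq {B : Matrix (Fin 4) (Fin 4) K}
    (hB : Bᵀ * antidiagonal K * B.map σ = antidiagonal K)
    (hlow : ∀ i j, j < i → B i j = 0) (hdiag : ∀ i, B i i = 1) :
    ∃ x : UnitriangularUnitary σ, toMatrix x = B := by
  have h := fun i j => congrFun₂ hB i j
  have h10 := hlow 1 0 (by decide)
  have h20 := hlow 2 0 (by decide)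
  have h30 := hlow 3 0 (by decide)
  have h21 := hlow 2 1 (by decide)
  have h31 := hlow 3 1 (by decide)
  have h32 := hlow 3 2 (by decide)
  have h13 := h 1 3
  have h22 := h 2 2
  have h23 := h 3 2
  have h33 := h 3 3
  simp [antidiagonal, Matrix.mul_apply, Fin.sum_univ_four, h21, h31, h32, hdiag]
    at h13 h22 h23 h33
  have hf : B 2 3 = -σ (B 0 1) := by
    rw [← hσ.out (B 2 3), ← map_neg]
    exact congrArg σ (by linear_combination h13)
  have he : B 1 3 = -σ (B 0 2) - B 1 2 * σ (B 0 1) := by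
    rw [hf] at h23
    linear_combination h23 + σ (B 0 1) * h22
  rw [he, hf] at h33
  simp only [map_sub, map_neg, map_mul, hσ.out _] at h33
  refine ⟨⟨B 0 1, B 0 2, B 1 2, B 0 3, by linear_combination h22, ?_⟩, ?_⟩
  · simp only [map_add, map_mul, hσ.out _]
    linear_combination h33 - B 0 1 * σ (B 0 1) * h22
  · ext i j
    fin_cases i <;> fin_cases j <;>
      simp [toMatrix, h10, h20, h30, h21, h31, h32, hdiag, he, hf]

/-- A matrix normalizing the unitriangular unitary group is upper triangular. -/
theorem upperTriangular_of_normalizes {u : K} (hu : σ u ≠ u) {B : Matrix (Fin 4) (Fin 4) K}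
    (h₁ : ∀ x : UnitriangularUnitary σ, ∃ y : UnitriangularUnitary σ,
      B * toMatrix x = toMatrix y * B)
    (h₂ : ∀ y : UnitriangularUnitary σ, ∃ x : UnitriangularUnitary σ,
      B * toMatrix x = toMatrix y * B) :
    ∀ i j, j < i → B i j = 0 := by
  have hne : u - σ u ≠ 0 := sub_ne_zero.mpr hu.symm
  have hskew : u - σ u + σ (u - σ u) = 0 := by rw [map_sub, hσ.out u]; ring
  set s : UnitriangularUnitary σ := ofSkew 0 (u - σ u) 0 hskew (by simp) with hs
  obtain ⟨x₁, e₁⟩ := h₂ (ofA σ 1)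
  obtain ⟨x₂, e₂⟩ := h₂ s
  obtain ⟨y₁, e₃⟩ := h₁ (ofA σ 1)
  obtain ⟨y₂, e₄⟩ := h₁ s
  have h10 : B 1 0 = 0 := by
    simpa [toMatrix, ofA, Matrix.mul_apply, Fin.sum_univ_four] using congrFun₂ e₁ 0 0
  have h30 : B 3 0 = 0 := by
    simpa [toMatrix, ofA, Matrix.mul_apply, Fin.sum_univ_four] using congrFun₂ e₁ 2 0
  have h20 : B 2 0 = 0 := by
    simpa [toMatrix, ofSkew, hs, hne, Matrix.mul_apply, Fin.sum_univ_four] using congrFun₂ e₂ 1 0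
  have h32 : B 3 2 = 0 := by
    simpa [toMatrix, ofA, Matrix.mul_apply, Fin.sum_univ_four] using congrFun₂ e₃ 3 3
  have h31 : B 3 1 = 0 := by
    simpa [toMatrix, ofSkew, hs, hne, Matrix.mul_apply, Fin.sum_univ_four] using congrFun₂ e₄ 3 2
  have h21 : B 2 1 = 0 := by
    simpa [toMatrix, ofSkew, hs, hne, h32, Matrix.mul_apply, Fin.sum_univ_four]
      using congrFun₂ e₄ 2 2
  intro i j hij
  fin_cases i <;> fin_cases j <;> simp at hij ⊢ <;> assumption

end UnitriangularUnitary

/-- An upper triangular matrix of `p`-power order in characteristic `p` has unit diagonal. -/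
theorem Matrix.diag_eq_one_of_pow_eq_one {K m : Type*} [Field K] [Fintype m] [LinearOrder m]
    (p : ℕ) [Fact p.Prime] [CharP K p] {B : Matrix m m K} (hlow : ∀ i j, j < i → B i j = 0) {k : ℕ}
    (hk : B ^ p ^ k = 1) (i : m) : B i i = 1 := by
  have hpow : ∀ t : ℕ, (∀ i j, j < i → (B ^ t) i j = 0) ∧ ∀ i, (B ^ t) i i = B i i ^ t := by
    intro t
    induction t with
    | zero => exact ⟨fun i j hij => by simp [Matrix.one_apply_ne hij.ne'], by simp⟩
    | succ t ih =>
      constructor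
      · intro i j hij
        rw [pow_succ, Matrix.mul_apply]
        refine Finset.sum_eq_zero fun l _ => ?_
        rcases lt_or_ge l i with h | h
        · rw [ih.1 i l h, zero_mul]
        · rw [hlow l j (hij.trans_le h), mul_zero]
      · intro i
        rw [pow_succ, Matrix.mul_apply, Finset.sum_eq_single i, ih.2, pow_succ]
        · intro l _ hl
          rcases lt_or_gt_of_ne hl with h | h
          · rw [ih.1 i l h, zero_mul]
          · rw [hlow l i h, mul_zero]
        · simp
  have h := (hpow (p ^ k)).2 i
  rw [hk, Matrix.one_apply_eq] at h
  exact iterateFrobenius_inj K p k (by simpa [iterateFrobenius_def] using h.symm)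

/-- A `p`-subgroup containing every `p`-element of its normalizer is a Sylow subgroup. -/
theorem IsPGroup.exists_sylow_eq {G : Type*} [Group G] [Finite G] {p : ℕ} [Fact p.Prime]
    {R : Subgroup G} (hR : IsPGroup p R)
    (h : ∀ g ∈ Subgroup.normalizer (R : Set G), (∃ k : ℕ, g ^ p ^ k = 1) → g ∈ R) :
    ∃ Q : Sylow p G, (Q : Subgroup G) = R := by
  obtain ⟨Q, hQ⟩ := hR.exists_le_sylow
  refine ⟨Q, le_antisymm ?_ hQ⟩
  by_contra hne
  have hnil := Q.isPGroup'.isNilpotent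
  have hlt : R.subgroupOf Q < ⊤ := by
    rw [lt_top_iff_ne_top, Ne, Subgroup.subgroupOf_eq_top]
    exact hne
  obtain ⟨g, hg, hgR⟩ := SetLike.exists_of_lt (Group.normalizerCondition_of_isNilpotent _ hlt)
  refine hgR (Subgroup.mem_subgroupOf.mpr (h g.1 ?_ ?_))
  · rw [Subgroup.mem_normalizer_iff] at hg ⊢
    intro x
    constructor
    · intro hx
      exact Subgroup.mem_subgroupOf.mp ((hg ⟨x, hQ hx⟩).mp (Subgroup.mem_subgroupOf.mpr hx))
    · intro hx
      have hxQ : x ∈ (Q : Subgroup G) := by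
        have := mul_mem (mul_mem (inv_mem g.2) (hQ hx)) g.2
        simpa [mul_assoc] using this
      exact Subgroup.mem_subgroupOf.mp ((hg ⟨x, hxQ⟩).mpr (Subgroup.mem_subgroupOf.mpr hx))
  · obtain ⟨k, hk⟩ := Q.isPGroup' g
    exact ⟨k, congrArg Subtype.val hk⟩

section ChangeOfBasis

variable {K : Type*} [Field K] {σ : K →+* K} {J M N : Matrix (Fin 4) (Fin 4) K}

theorem conj_unitary_of_isometry (hMN : M * N = 1) (hJ : Mᵀ * M.map σ = J)
    {B : Matrix (Fin 4) (Fin 4) K} (hB : Bᵀ * J * B.map σ = J) :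
    (M * B * N)ᵀ * (M * B * N).map σ = 1 := by
  calc (M * B * N)ᵀ * (M * B * N).map σ
      = Nᵀ * (Bᵀ * (Mᵀ * M.map σ) * B.map σ) * N.map σ := by
        simp only [Matrix.transpose_mul, Matrix.map_mul, Matrix.mul_assoc]
    _ = (M * N)ᵀ * (M * N).map σ := by
        rw [hJ, hB, ← hJ]
        simp only [Matrix.transpose_mul, Matrix.map_mul, Matrix.mul_assoc]
    _ = 1 := by simp [hMN]

theorem isometry_conj_of_unitary (hMN : M * N = 1) (hJ : Mᵀ * M.map σ = J)
    {A : Matrix (Fin 4) (Fin 4) K} (hA : Aᵀ * A.map σ = 1) :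
    (N * A * M)ᵀ * J * (N * A * M).map σ = J := by
  calc (N * A * M)ᵀ * J * (N * A * M).map σ
      = Mᵀ * (Aᵀ * ((M * N)ᵀ * (M * N).map σ) * A.map σ) * M.map σ := by
        rw [← hJ]
        simp only [Matrix.transpose_mul, Matrix.map_mul, Matrix.mul_assoc]
    _ = J := by simp [hMN, hA, hJ]

theorem conj_pow_of_mul_eq_one (hMN : M * N = 1) (hNM : N * M = 1) (A : Matrix (Fin 4) (Fin 4) K) (k : ℕ) :
    (N * A * M) ^ k = N * A ^ k * M := by
  induction k with
  | zero => simp [hNM]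
  | succ k ih =>
    rw [pow_succ, ih, pow_succ]
    calc N * A ^ k * M * (N * A * M) = N * A ^ k * (M * N) * A * M := by
          simp only [Matrix.mul_assoc]
      _ = N * (A ^ k * A) * M := by simp only [hMN, Matrix.mul_one, Matrix.mul_assoc]

theorem eq_of_conj_eq (hNM : N * M = 1) {A B : Matrix (Fin 4) (Fin 4) K}
    (h : M * A * N = M * B * N) : A = B := by
  have key : ∀ C : Matrix (Fin 4) (Fin 4) K,
      N * (M * C * N) * M = C := fun C => by
    calc N * (M * C * N) * M = (N * M) * C * (N * M) := by simp only [Matrix.mul_assoc]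
      _ = C := by rw [hNM, Matrix.one_mul, Matrix.mul_one]
  rw [← key A, h, key B]

end ChangeOfBasis

section GaloisField

variable (p n : ℕ) [Fact p.Prime]

theorem frobq_apply (x : GaloisField p (2 * n)) : frobq p n x = x ^ p ^ n :=
  iterateFrobenius_def _ _ _

variable {n}

theorem natCard_galoisField (hn : 0 < n) :
    Nat.card (GaloisField p (2 * n)) = p ^ n * p ^ n := by
  rw [GaloisField.card p (2 * n) (by omega), two_mul, pow_add]

theorem frobq_involutive (hn : 0 < n) : Function.Involutive (frobq p n) := fun x => by
  have := Fintype.ofFinite (GaloisField p (2 * n))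
  rw [frobq_apply, frobq_apply, ← pow_mul, ← natCard_galoisField p hn, Nat.card_eq_fintype_card]
  exact FiniteField.pow_card x

theorem one_lt_prime_pow (hn : 0 < n) : 1 < p ^ n :=
  Nat.one_lt_pow hn.ne' (Fact.out : p.Prime).one_lt

theorem exists_frobq_ne (hn : 0 < n) : ∃ u, frobq p n u ≠ u := by
  by_contra! h
  have hq := one_lt_prime_pow p hn
  obtain ⟨g, hg⟩ := IsCyclic.exists_ofOrder_eq_natCard (α := (GaloisField p (2 * n))ˣ)
  have hpow : g ^ (p ^ n - 1) = 1 := by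
    have h1 : g ^ (p ^ n - 1) * g = g := by
      rw [← pow_succ, Nat.sub_add_cancel hq.le]
      ext
      rw [Units.val_pow_eq_pow_val, ← frobq_apply, h]
    exact mul_eq_right.mp h1
  have hdvd := orderOf_dvd_of_pow_eq_one hpow
  rw [hg, Nat.card_units, natCard_galoisField p hn] at hdvd
  have hle := Nat.le_of_dvd (by omega) hdvd
  have : p ^ n * 1 < p ^ n * p ^ n := Nat.mul_lt_mul_of_pos_left hq (by omega)
  omega

theorem exists_mul_frobq_eq_neg_one (hn : 0 < n) : ∃ c, c * frobq p n c = -1 := by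
  have hq := one_lt_prime_pow p hn
  obtain ⟨g, hg⟩ := IsCyclic.exists_generator (α := (GaloisField p (2 * n))ˣ)
  obtain ⟨i, hi⟩ := (Submonoid.mem_powers_iff _ _).mp
    ((mem_powers_iff_mem_zpowers).mpr (hg (-1)))
  have hord := orderOf_eq_card_of_forall_mem_zpowers hg
  have hneg : (-1 : (GaloisField p (2 * n))ˣ) ^ (p ^ n - 1) = 1 := by
    have h1 : (-1 : (GaloisField p (2 * n))ˣ) ^ (p ^ n - 1) * (-1) = -1 := by
      rw [← pow_succ, Nat.sub_add_cancel hq.le]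
      ext
      rw [Units.val_pow_eq_pow_val, ← frobq_apply]
      simp
    exact mul_eq_right.mp h1
  rw [← hi, ← pow_mul] at hneg
  have hdvd := orderOf_dvd_of_pow_eq_one hneg
  have hfac : p ^ n * p ^ n - 1 = (p ^ n + 1) * (p ^ n - 1) := by
    obtain ⟨m, hm⟩ := Nat.exists_eq_add_of_lt hq
    rw [hm]
    simp only [Nat.add_sub_cancel]
    rw [Nat.sub_eq_iff_eq_add (Nat.mul_pos (by omega) (by omega))]
    ring
  rw [hord, Nat.card_units, natCard_galoisField p hn, hfac] at hdvd
  obtain ⟨k, rfl⟩ := Nat.dvd_of_mul_dvd_mul_right (by omega) hdvd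
  refine ⟨((g ^ k : (GaloisField p (2 * n))ˣ) : GaloisField p (2 * n)), ?_⟩
  rw [frobq_apply, ← pow_succ', ← Units.val_pow_eq_pow_val, ← pow_mul, Nat.mul_comm k, hi]
  simp

end GaloisField

section Sylow

open UnitriangularUnitary

variable {p n : ℕ} [Fact p.Prime] {M N : Matrix (Fin 4) (Fin 4) (GaloisField p (2 * n))}

/-- The element of `SU₄(q)` obtained by a change of basis from an isometry of determinant one of
the antidiagonal form. -/
noncomputable def su4OfIsometry (hMN : M * N = 1)
    (hJ : Mᵀ * M.map (frobq p n) = antidiagonal (GaloisField p (2 * n)))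
    (B : Matrix (Fin 4) (Fin 4) (GaloisField p (2 * n)))
    (hB : Bᵀ * antidiagonal (GaloisField p (2 * n)) * B.map (frobq p n) =
      antidiagonal (GaloisField p (2 * n))) (hdet : B.det = 1) : SU4 p n :=
  ⟨⟨M * B * N, by
    have h := congrArg Matrix.det hMN
    rw [Matrix.det_mul, Matrix.det_one] at h
    rw [Matrix.det_mul, Matrix.det_mul, hdet, mul_one, h]⟩,
    conj_unitary_of_isometry hMN hJ hB⟩

variable [Fact (Function.Involutive (frobq p n))]

/-- The embedding of the unitriangular unitary group into `SU₄(q)`. -/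
noncomputable def toSU4 (hMN : M * N = 1) (hNM : N * M = 1)
    (hJ : Mᵀ * M.map (frobq p n) = antidiagonal (GaloisField p (2 * n))) :
    UnitriangularUnitary (frobq p n) →* SU4 p n where
  toFun x := su4OfIsometry hMN hJ (toMatrix x) (toMatrix_isometry x) (det_toMatrix x)
  map_one' := by
    refine Subtype.ext (Subtype.ext ?_)
    change M * toMatrix 1 * N = 1
    rw [toMatrix_one, Matrix.mul_one, hMN]
  map_mul' x y := by
    refine Subtype.ext (Subtype.ext ?_)
    change M * toMatrix (x * y) * N = M * toMatrix x * N * (M * toMatrix y * N)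
    rw [toMatrix_mul]
    calc M * (toMatrix x * toMatrix y) * N = M * toMatrix x * 1 * toMatrix y * N := by
          simp only [Matrix.mul_one, Matrix.mul_assoc]
      _ = _ := by rw [← hNM]; simp only [Matrix.mul_assoc]

variable {hMN : M * N = 1} {hNM : N * M = 1}
  {hJ : Mᵀ * M.map (frobq p n) = antidiagonal (GaloisField p (2 * n))}

theorem coe_toSU4 (x : UnitriangularUnitary (frobq p n)) :
    ((toSU4 hMN hNM hJ x : SU4 p n) : SpecialLinearGroup (Fin 4) (GaloisField p (2 * n))).1 =
      M * toMatrix x * N := rfl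

/-- The unitriangular unitary group meets the center of `SU₄(q)` trivially. -/
theorem eq_one_of_toSU4_mem_center {x : UnitriangularUnitary (frobq p n)}
    (hx : toSU4 hMN hNM hJ x ∈ Subgroup.center (SU4 p n)) : x = 1 := by
  have h := Subgroup.mem_center_iff.mp hx
    (su4OfIsometry hMN hJ (antidiagonal _)
      (by rw [antidiagonal_map, antidiagonal_transpose, antidiagonal_mul_self, Matrix.one_mul])
      det_antidiagonal)
  have h' : M * antidiagonal _ * N * (M * toMatrix x * N) =
      M * toMatrix x * N * (M * antidiagonal _ * N) :=
    congrArg (fun g : SU4 p n => (g : SpecialLinearGroup (Fin 4) (GaloisField p (2 * n))).1) h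
  have key : ∀ A B : Matrix (Fin 4) (Fin 4) (GaloisField p (2 * n)),
      M * A * N * (M * B * N) = M * (A * B) * N := fun A B => by
    calc M * A * N * (M * B * N) = M * A * (N * M) * B * N := by simp only [Matrix.mul_assoc]
      _ = M * (A * B) * N := by rw [hNM, Matrix.mul_one]; simp only [Matrix.mul_assoc]
  rw [key, key] at h'
  exact eq_one_of_commute_antidiagonal (eq_of_conj_eq hNM h').symm

/-- A `p`-element of `SU₄(q)` normalizing the unitriangular unitary group belongs to it. -/
theorem mem_range_toSU4_of_mem_normalizer {u : GaloisField p (2 * n)} (hu : frobq p n u ≠ u)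
    {g : SU4 p n} (hg : g ∈ Subgroup.normalizer ((toSU4 hMN hNM hJ).range : Set (SU4 p n)))
    {k : ℕ} (hk : g ^ p ^ k = 1) : g ∈ (toSU4 hMN hNM hJ).range := by
  set A : Matrix (Fin 4) (Fin 4) (GaloisField p (2 * n)) :=
    (g : SpecialLinearGroup (Fin 4) (GaloisField p (2 * n))).1 with hA
  have hconj : ∀ x y, g * toSU4 hMN hNM hJ x * g⁻¹ = toSU4 hMN hNM hJ y →
      N * A * M * toMatrix x = toMatrix y * (N * A * M) := by
    intro x y h
    rw [mul_inv_eq_iff_eq_mul] at h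
    have h' : A * (M * toMatrix x * N) = M * toMatrix y * N * A :=
      congrArg (fun g : SU4 p n => (g : SpecialLinearGroup (Fin 4) (GaloisField p (2 * n))).1) h
    calc N * A * M * toMatrix x = N * (A * (M * toMatrix x * N)) * M := by
          simp only [Matrix.mul_assoc, hNM, Matrix.mul_one]
      _ = (N * M) * (toMatrix y * (N * A * M)) := by rw [h']; simp only [Matrix.mul_assoc]
      _ = _ := by rw [hNM, Matrix.one_mul]
  rw [Subgroup.mem_normalizer_iff] at hg
  have hlow := upperTriangular_of_normalizes hu (B := N * A * M)
    (fun x => by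
      obtain ⟨y, hy⟩ := (hg _).mp ⟨x, rfl⟩
      exact ⟨y, hconj x y hy.symm⟩)
    (fun y => by
      obtain ⟨x, hx⟩ := (hg (g⁻¹ * toSU4 hMN hNM hJ y * g)).mpr
        ⟨y, by group⟩
      exact ⟨x, hconj x y (by rw [hx]; group)⟩)
  have hpow : (N * A * M) ^ p ^ k = 1 := by
    have hAk : A ^ p ^ k = 1 := by
      have := congrArg
        (fun g : SU4 p n => (g : SpecialLinearGroup (Fin 4) (GaloisField p (2 * n))).1) hk
      simpa using this
    rw [conj_pow_of_mul_eq_one hMN hNM, hAk, Matrix.mul_one, hNM]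
  obtain ⟨x, hx⟩ := exists_toMatrix_eq (isometry_conj_of_unitary hMN hJ g.2) hlow
    (Matrix.diag_eq_one_of_pow_eq_one p hlow hpow)
  refine ⟨x, Subtype.ext (Subtype.ext ?_)⟩
  rw [coe_toSU4, hx]
  calc M * (N * A * M) * N = (M * N) * A * (M * N) := by simp only [Matrix.mul_assoc]
    _ = A := by rw [hMN, Matrix.one_mul, Matrix.mul_one]

/-- Every Sylow `p`-subgroup of `PSU₄(q)` is isomorphic to the unitriangular unitary group. -/
theorem nonempty_sylow_mulEquiv (hn : 0 < n) (S : Sylow p (PSU4 p n)) :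
    Nonempty (S ≃* UnitriangularUnitary (frobq p n)) := by
  obtain ⟨u, hu⟩ := exists_frobq_ne p hn
  obtain ⟨c, hc⟩ := exists_mul_frobq_eq_neg_one p hn
  obtain ⟨M, N, hMN, hNM, hJ⟩ := exists_hyperbolic_basis (frobq_involutive p hn) hu hc
  obtain ⟨Q, hQ⟩ := IsPGroup.exists_sylow_eq (R := (toSU4 hMN hNM hJ).range)
    ((isPGroup p).of_surjective _ (toSU4 hMN hNM hJ).rangeRestrict_surjective)
    (fun g hg ⟨k, hk⟩ => mem_range_toSU4_of_mem_normalizer hu hg hk)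
  set π := QuotientGroup.mk' (Subgroup.center (SU4 p n))
  have hinj : Function.Injective (π.comp (toSU4 hMN hNM hJ)) := by
    rw [injective_iff_map_eq_one]
    intro x hx
    exact eq_one_of_toSU4_mem_center ((QuotientGroup.eq_one_iff _).mp hx)
  have hrange : ((Q.mapSurjective (QuotientGroup.mk'_surjective _) : Sylow p (PSU4 p n)) :
      Subgroup (PSU4 p n)) = (π.comp (toSU4 hMN hNM hJ)).range := by
    rw [Sylow.coe_mapSurjective, hQ, MonoidHom.range_comp]
  exact ⟨(S.equiv _).trans ((MulEquiv.subgroupCongr hrange).trans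
    (MonoidHom.ofInjective hinj).symm)⟩

end Sylow

/-- For `q > 2` and `x ∈ J(S) \ ⁅S,S⁆`, the centralizer of `x` in `S` is `J(S)`. -/
theorem psu4_sylow_centralizer_of_thompson_element
    (p n : ℕ) [Fact p.Prime] (hn : 0 < n) (q : ℕ) (hq : q = p ^ n) (hq2 : 2 < q)
    (S : Sylow p (PSU4 p n))
    (x : ↥(S : Subgroup (PSU4 p n)))
    (hx : x ∈ Thompson p ↥(S : Subgroup (PSU4 p n)))
    (hx' : x ∉ (⁅(⊤ : Subgroup ↥(S : Subgroup (PSU4 p n))), ⊤⁆ : Subgroup ↥(S : Subgroup (PSU4 p n)))) :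
    Subgroup.centralizer ({x} : Set ↥(S : Subgroup (PSU4 p n))) = Thompson p ↥(S : Subgroup (PSU4 p n)) := by
  have hσ : Fact (Function.Involutive (frobq p n)) := ⟨frobq_involutive p hn⟩
  obtain ⟨u, hu⟩ := exists_frobq_ne p hn
  obtain ⟨e⟩ := nonempty_sylow_mulEquiv hn S
  exact UnitriangularUnitary.centralizer_eq_thompson hu p e hx hx'
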